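/- Let Ω ⊂ ℝ^d be a nonempty bounded open set and let E be a dyadic function on Ω that is positive and regular. If there exists a function α : Ω → ℝ such that τ_E(x,p) = τ_E(x,0) + α(x)·p for every x ∈ Ω and every p ∈ ℝ, then h_E(x) = α(x) for every x ∈ Ω. -/

import Mathlib

open MeasureTheory Filter Metric Set
open scoped ENNReal Topology

noncomputable section

/-- The dyadic cube of scale `j` with index `k`:
`λ = ∏_i [k_i 2^{-j}, (k_i+1) 2^{-j})`. -/
def dyadicCube (d : ℕ) (j : ℕ) (k : Fin d → ℤ) : Set (Fin d → ℝ) :=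
  {y | ∀ i, (k i : ℝ) * 2 ^ (-(j : ℤ)) ≤ y i ∧ y i < ((k i : ℝ) + 1) * 2 ^ (-(j : ℤ))}

/-- The index of the unique dyadic cube of scale `j` containing `x`. -/
def dyadicIndex (d : ℕ) (j : ℕ) (x : Fin d → ℝ) : Fin d → ℤ :=
  fun i => ⌊x i * 2 ^ (j : ℕ)⌋

/-- The lower exponent of a dyadic function `e` at `x`:
`h_E(x) = liminf_{j→∞} log e_{λ_j(x)} / log 2^{-j}`, taken in `[-∞,∞]` with the
convention `log 0 = -∞` (so that the quotient by the negative quantity `log 2^{-j}`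
is `+∞` when `e_{λ_j(x)} = 0`). -/
def lowerExp {d : ℕ} (e : ℕ → (Fin d → ℤ) → ℝ) (x : Fin d → ℝ) : EReal :=
  Filter.liminf
    (fun j : ℕ =>
      if e j (dyadicIndex d j x) = 0 then (⊤ : EReal)
      else ((Real.log (e j (dyadicIndex d j x)) / Real.log ((2 : ℝ) ^ (-(j : ℤ))) : ℝ) : EReal))
    Filter.atTop

/-- The structure function `S_j(ω,p) = Σ_{λ ⊆ ω, ⟨λ⟩ = j} (e_λ)^p` of a dyadic
function `e` on `ω` (a finite sum when `ω` is bounded). -/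
def structFn {d : ℕ} (e : ℕ → (Fin d → ℤ) → ℝ) (ω : Set (Fin d → ℝ)) (j : ℕ) (p : ℝ) : ℝ :=
  ∑ᶠ k ∈ {k : Fin d → ℤ | dyadicCube d j k ⊆ ω}, e j k ^ p

/-- The scaling function `τ_E^ω(p) = liminf_{j→∞} log S_j(ω,p) / log 2^{-j}`. -/
def scalingFn {d : ℕ} (e : ℕ → (Fin d → ℤ) → ℝ) (ω : Set (Fin d → ℝ)) (p : ℝ) : ℝ :=
  Filter.liminf
    (fun j : ℕ => Real.log (structFn e ω j p) / Real.log ((2 : ℝ) ^ (-(j : ℤ))))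
    Filter.atTop

/-- The local scaling function `τ_E(x,p) = lim_{r→0⁺} τ_E^{B(x,r)∩Ω}(p)`; since
`r ↦ τ_E^{B(x,r)∩Ω}(p)` is nonincreasing in `r`, the limit equals the supremum
over `r > 0`. -/
def locScalingFn {d : ℕ} (e : ℕ → (Fin d → ℤ) → ℝ) (Ω : Set (Fin d → ℝ))
    (x : Fin d → ℝ) (p : ℝ) : ℝ :=
  ⨆ r : {r : ℝ // 0 < r}, scalingFn e (Metric.ball x r.1 ∩ Ω) p

/-- The local multifractal spectrum
`d_E(x,H) = lim_{r→0⁺} dim_H {y ∈ B(x,r) ∩ Ω : h_E(y) = H}`; since the spectrum on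
`B(x,r) ∩ Ω` is nondecreasing in `r`, the limit equals the infimum over `r > 0`. -/
def locSpectrum {d : ℕ} (e : ℕ → (Fin d → ℤ) → ℝ) (Ω : Set (Fin d → ℝ))
    (x : Fin d → ℝ) (H : ℝ) : ℝ≥0∞ :=
  ⨅ (r : ℝ) (_ : 0 < r),
    dimH {y ∈ Metric.ball x r ∩ Ω | lowerExp e y = (H : EReal)}

/-- The dyadic function `e` is positive and regular on `Ω`: every `e_λ` with `λ ⊆ Ω`
is positive, and `C₁ 2^{-Bj} ≤ e_λ ≤ C₂ 2^{-Aj}` for all dyadic `λ ⊆ Ω` of scale `j`. -/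
def PositiveRegular {d : ℕ} (e : ℕ → (Fin d → ℤ) → ℝ) (Ω : Set (Fin d → ℝ)) : Prop :=
  (∀ j k, dyadicCube d j k ⊆ Ω → 0 < e j k) ∧
  ∃ C₁ C₂ A B : ℝ, 0 < C₁ ∧ 0 < C₂ ∧
    ∀ j k, dyadicCube d j k ⊆ Ω →
      C₁ * 2 ^ (-(B * j)) ≤ e j k ∧ e j k ≤ C₂ * 2 ^ (-(A * j))

theorem log_two_zpow_neg (j : ℕ) : Real.log ((2 : ℝ) ^ (-(j : ℤ))) = -(j * Real.log 2) := by
  rw [zpow_neg, zpow_natCast, Real.log_inv, Real.log_pow]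

theorem mem_dyadicCube_dyadicIndex {d : ℕ} (j : ℕ) (x : Fin d → ℝ) :
    x ∈ dyadicCube d j (dyadicIndex d j x) := by
  intro i
  have h2 : (0 : ℝ) < 2 ^ j := by positivity
  rw [zpow_neg, zpow_natCast, ← div_eq_mul_inv, ← div_eq_mul_inv, div_le_iff₀ h2, lt_div_iff₀ h2]
  exact ⟨Int.floor_le _, Int.lt_floor_add_one _⟩

theorem corner_mem_dyadicCube {d : ℕ} (j : ℕ) (k : Fin d → ℤ) :
    (fun i => (k i : ℝ) * 2 ^ (-(j : ℤ))) ∈ dyadicCube d j k := by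
  intro i
  have h2 : (0 : ℝ) < 2 ^ (-(j : ℤ)) := by positivity
  exact ⟨le_rfl, by nlinarith⟩

theorem dist_le_of_mem_dyadicCube {d : ℕ} {j : ℕ} {k : Fin d → ℤ} {x y : Fin d → ℝ}
    (hx : x ∈ dyadicCube d j k) (hy : y ∈ dyadicCube d j k) :
    dist y x ≤ (1 / 2) ^ j := by
  refine (dist_pi_le_iff (by positivity)).2 fun i => ?_
  have e : ((1 : ℝ) / 2) ^ j = 2 ^ (-(j : ℤ)) := by
    rw [zpow_neg, zpow_natCast, one_div, inv_pow]
  have h1 := hx i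
  have h2 := hy i
  rw [Real.dist_eq, abs_le, e]
  constructor <;> nlinarith

/-- Small dyadic cubes around a point of an open set lie in that set. -/
theorem eventually_dyadicCube_subset {d : ℕ} {U : Set (Fin d → ℝ)} (hU : IsOpen U)
    {x : Fin d → ℝ} (hx : x ∈ U) :
    ∀ᶠ j : ℕ in atTop, dyadicCube d j (dyadicIndex d j x) ⊆ U := by
  obtain ⟨r, hr, hrU⟩ := Metric.isOpen_iff.1 hU x hx
  have ht : Tendsto (fun j : ℕ => ((1 : ℝ) / 2) ^ j) atTop (𝓝 0) :=
    tendsto_pow_atTop_nhds_zero_of_lt_one (by norm_num) (by norm_num)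
  filter_upwards [ht.eventually_lt_const hr] with j hj y hy
  exact hrU ((dist_le_of_mem_dyadicCube (mem_dyadicCube_dyadicIndex j x) hy).trans_lt hj)

/-- A bounded set contains at most exponentially many dyadic cubes of scale `j`. -/
theorem exists_finset_dyadicCube_subset {d : ℕ} {Ω : Set (Fin d → ℝ)}
    (hΩ : Bornology.IsBounded Ω) :
    ∃ K : ℕ, ∀ j : ℕ, ∃ s : Finset (Fin d → ℤ), s.card ≤ (2 ^ (K + j)) ^ d ∧
      {k : Fin d → ℤ | dyadicCube d j k ⊆ Ω} ⊆ s := by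
  obtain ⟨R, hR⟩ := hΩ.exists_norm_le
  obtain ⟨K, hK⟩ := pow_unbounded_of_one_lt R (one_lt_two : (1 : ℝ) < 2)
  refine ⟨K + 2, fun j => ⟨Fintype.piFinset fun _ => Finset.Icc (-2 ^ (K + j)) (2 ^ (K + j)),
    ?_, ?_⟩⟩
  · rw [Fintype.card_piFinset, Finset.prod_const, Finset.card_univ, Fintype.card_fin]
    gcongr
    rw [Int.card_Icc]
    have : (1 : ℤ) ≤ 2 ^ (K + j) := one_le_pow₀ (by norm_num)
    rw [Int.toNat_le]
    push_cast
    rw [show K + 2 + j = (K + j) + 2 by ring, pow_add _ (K + j) 2]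
    linarith
  · intro k hk
    rw [Finset.mem_coe, Fintype.mem_piFinset]
    intro i
    have h := (norm_le_pi_norm _ i).trans (hR _ (hk (corner_mem_dyadicCube j k)))
    have h2 : (0 : ℝ) < 2 ^ j := by positivity
    rw [Real.norm_eq_abs, zpow_neg, zpow_natCast, ← div_eq_mul_inv, abs_div, abs_of_pos h2,
      div_le_iff₀ h2] at h
    have h3 : |(k i : ℝ)| ≤ 2 ^ (K + j) := by
      rw [pow_add]
      nlinarith
    rw [Finset.mem_Icc, ← abs_le]
    exact_mod_cast h3

theorem PositiveRegular.exists_abs_log_le {d : ℕ} {e : ℕ → (Fin d → ℤ) → ℝ}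
    {Ω : Set (Fin d → ℝ)} (h : PositiveRegular e Ω) :
    ∃ D : ℝ, 0 ≤ D ∧ ∀ j k, dyadicCube d j k ⊆ Ω → |Real.log (e j k)| ≤ D * (j + 1) := by
  obtain ⟨hpos, C₁, C₂, A, B, h1, h2, hC⟩ := h
  have hl : 0 < Real.log 2 := Real.log_pos (by norm_num)
  refine ⟨|Real.log C₁| + |Real.log C₂| + (|A| + |B|) * Real.log 2, by positivity,
    fun j k hk => ?_⟩
  obtain ⟨hle, hge⟩ := hC j k hk
  have e1 := Real.log_le_log (by positivity) hle
  have e2 := Real.log_le_log (hpos j k hk) hge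
  rw [Real.log_mul (by positivity) (by positivity), Real.log_rpow (by norm_num)] at e1 e2
  have hj : (0 : ℝ) ≤ j := j.cast_nonneg
  have hjl : 0 ≤ j * Real.log 2 := by positivity
  have a1 := mul_le_mul_of_nonneg_right (le_abs_self B) hjl
  have a2 := mul_le_mul_of_nonneg_right (neg_abs_le A) hjl
  have c1 := neg_abs_le (Real.log C₁)
  have c2 := le_abs_self (Real.log C₂)
  have p1 := mul_nonneg (abs_nonneg (Real.log C₁)) hj
  have p2 := mul_nonneg (abs_nonneg (Real.log C₂)) hj
  have p3 := abs_nonneg (Real.log C₁)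
  have p4 := abs_nonneg (Real.log C₂)
  have q1 := mul_nonneg (abs_nonneg A) hl.le
  have q2 := mul_nonneg (abs_nonneg B) hl.le
  have q3 := mul_nonneg (abs_nonneg A) hjl
  have q4 := mul_nonneg (abs_nonneg B) hjl
  rw [abs_le]
  constructor <;> linarith

section StructureFunction

variable {d : ℕ} {e : ℕ → (Fin d → ℤ) → ℝ} {Ω ω : Set (Fin d → ℝ)}

theorem finite_dyadicCube_subset (hΩ : Bornology.IsBounded Ω) (j : ℕ) :
    {k : Fin d → ℤ | dyadicCube d j k ⊆ Ω}.Finite := by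
  obtain ⟨K, hK⟩ := exists_finset_dyadicCube_subset hΩ
  obtain ⟨s, -, hs⟩ := hK j
  exact s.finite_toSet.subset hs

theorem rpow_le_structFn (hω : Bornology.IsBounded ω)
    (hpos : ∀ j k, dyadicCube d j k ⊆ ω → 0 < e j k) {j : ℕ} {k : Fin d → ℤ}
    (hk : dyadicCube d j k ⊆ ω) (p : ℝ) : e j k ^ p ≤ structFn e ω j p := by
  have hfin := finite_dyadicCube_subset hω j
  rw [structFn, finsum_mem_eq_finite_toFinset_sum _ hfin]
  refine Finset.single_le_sum (f := fun k => e j k ^ p) (fun k hk => ?_) (hfin.mem_toFinset.2 hk)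
  exact Real.rpow_nonneg (hpos j k (hfin.mem_toFinset.1 hk)).le p

theorem PositiveRegular.exists_structFn_le (h : PositiveRegular e Ω)
    (hω : Bornology.IsBounded ω) (hsub : ω ⊆ Ω) (p : ℝ) :
    ∃ M : ℝ, ∀ j : ℕ, structFn e ω j p ≤ Real.exp (M * (j + 1)) := by
  obtain ⟨D, hD, hlog⟩ := h.exists_abs_log_le
  obtain ⟨K, hK⟩ := exists_finset_dyadicCube_subset hω
  refine ⟨(K + 1) * d + D * |p|, fun j => ?_⟩
  obtain ⟨s, hcard, hs⟩ := hK j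
  have hfin := finite_dyadicCube_subset hω j
  have hterm : ∀ k ∈ hfin.toFinset, e j k ^ p ≤ Real.exp (D * (j + 1) * |p|) := by
    intro k hk
    have hkΩ := (hfin.mem_toFinset.1 hk : dyadicCube d j k ⊆ ω).trans hsub
    rw [Real.rpow_def_of_pos (h.1 j k hkΩ), Real.exp_le_exp]
    refine (le_abs_self _).trans ?_
    rw [abs_mul]
    exact mul_le_mul_of_nonneg_right (hlog j k hkΩ) (abs_nonneg p)
  have hsum := Finset.sum_le_card_nsmul _ _ _ hterm
  rw [structFn, finsum_mem_eq_finite_toFinset_sum _ hfin]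
  refine hsum.trans ?_
  rw [nsmul_eq_mul]
  have hc : ((hfin.toFinset.card : ℕ) : ℝ) ≤ (2 ^ (K + j)) ^ d := by
    have := (Finset.card_le_card (fun k hk => hs (hfin.mem_toFinset.1 hk))).trans hcard
    exact_mod_cast this
  have h2 : ((2 : ℝ) ^ (K + j)) ^ d ≤ Real.exp ((K + 1) * d * (j + 1)) := by
    have h2e : (2 : ℝ) ≤ Real.exp 1 := by
      have := Real.add_one_le_exp (1 : ℝ)
      linarith
    calc ((2 : ℝ) ^ (K + j)) ^ d ≤ (Real.exp 1 ^ (K + j)) ^ d := by gcongr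
      _ = Real.exp ((K + j) * d) := by
        rw [← pow_mul, ← Real.exp_nat_mul]
        push_cast
        ring_nf
      _ ≤ _ := by
        rw [Real.exp_le_exp]
        have : (0 : ℝ) ≤ (K * j + 1) * d := by positivity
        linarith
  calc _ ≤ Real.exp ((K + 1) * d * (j + 1)) * Real.exp (D * (j + 1) * |p|) := by
        gcongr
        exact hc.trans h2
    _ = _ := by
        rw [← Real.exp_add]
        ring_nf

theorem PositiveRegular.isBoundedUnder_ge_log_structFn (h : PositiveRegular e Ω)
    (hω : Bornology.IsBounded ω) (hsub : ω ⊆ Ω) (p : ℝ)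
    (hS : ∀ᶠ j : ℕ in atTop, 0 < structFn e ω j p) :
    IsBoundedUnder (· ≥ ·) atTop
      fun j : ℕ => Real.log (structFn e ω j p) / Real.log ((2 : ℝ) ^ (-(j : ℤ))) := by
  obtain ⟨M, hM⟩ := h.exists_structFn_le hω hsub p
  have hl : 0 < Real.log 2 := Real.log_pos (by norm_num)
  refine ⟨-(2 * |M| / Real.log 2), ?_⟩
  rw [eventually_map]
  filter_upwards [hS, eventually_ge_atTop 1] with j hSj hj
  have hj' : (1 : ℝ) ≤ j := by exact_mod_cast hj
  have hle := Real.log_le_log hSj (hM j)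
  rw [Real.log_exp] at hle
  have hM1 := mul_le_mul_of_nonneg_right (le_abs_self M) (by positivity : (0 : ℝ) ≤ j + 1)
  have hM2 := mul_le_mul_of_nonneg_left hj' (abs_nonneg M)
  rw [log_two_zpow_neg, div_neg, ge_iff_le, neg_le_neg_iff, div_le_div_iff₀ (by positivity) hl]
  have := mul_le_mul_of_nonneg_right
    (by linarith : Real.log (structFn e ω j p) ≤ 2 * |M| * j) hl.le
  linarith

/-- Every value below `τ_E(x,p)` is eventually below
`p · log e_{λ_j(x)} / log 2^{-j}`. -/
theorem PositiveRegular.eventually_lt_of_lt_locScalingFn (h : PositiveRegular e Ω)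
    (hΩo : IsOpen Ω) (hΩb : Bornology.IsBounded Ω) {x : Fin d → ℝ} (hx : x ∈ Ω) {p b : ℝ}
    (hb : b < locScalingFn e Ω x p) :
    ∀ᶠ j : ℕ in atTop,
      b < p * (Real.log (e j (dyadicIndex d j x)) / Real.log ((2 : ℝ) ^ (-(j : ℤ)))) := by
  have : Nonempty {r : ℝ // 0 < r} := ⟨⟨1, one_pos⟩⟩
  obtain ⟨⟨r, hr⟩, hbr⟩ := exists_lt_of_lt_ciSup hb
  have hsub : ball x r ∩ Ω ⊆ Ω := inter_subset_right
  have hωb := hΩb.subset hsub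
  have hcube := eventually_dyadicCube_subset (isOpen_ball.inter hΩo) ⟨mem_ball_self hr, hx⟩
  have hS : ∀ᶠ j : ℕ in atTop, 0 < e j (dyadicIndex d j x) ∧
      e j (dyadicIndex d j x) ^ p ≤ structFn e (ball x r ∩ Ω) j p := by
    filter_upwards [hcube] with j hj
    exact ⟨h.1 _ _ (hj.trans hsub),
      rpow_le_structFn hωb (fun j k hk => h.1 j k (hk.trans hsub)) hj p⟩
  have hlt := eventually_lt_of_lt_liminf hbr (h.isBoundedUnder_ge_log_structFn hωb hsub p
    (hS.mono fun j hj => (Real.rpow_pos_of_pos hj.1 p).trans_le hj.2))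
  filter_upwards [hS, hlt] with j hj hlt
  refine hlt.trans_le ?_
  have hlog := Real.log_le_log (Real.rpow_pos_of_pos hj.1 p) hj.2
  rw [Real.log_rpow hj.1] at hlog
  have hl : 0 < Real.log 2 := Real.log_pos (by norm_num)
  rw [← mul_div_assoc]
  refine div_le_div_of_nonpos_of_le ?_ hlog
  rw [log_two_zpow_neg, neg_nonpos]
  positivity

end StructureFunction

/-- If the local scaling function of a positive regular dyadic function `E` on a
nonempty bounded open set `Ω` is affine in `p` at every point,
`τ_E(x,p) = τ_E(x,0) + α(x) p`, then the lower exponent of `E` is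
`h_E(x) = α(x)` at every `x ∈ Ω`. -/
theorem lowerExp_eq_of_affine_locScalingFn {d : ℕ} (Ω : Set (Fin d → ℝ))
    (hΩo : IsOpen Ω) (hΩne : Ω.Nonempty) (hΩb : Bornology.IsBounded Ω)
    (e : ℕ → (Fin d → ℤ) → ℝ) (hreg : PositiveRegular e Ω)
    (α : (Fin d → ℝ) → ℝ)
    (haff : ∀ x ∈ Ω, ∀ p : ℝ,
      locScalingFn e Ω x p = locScalingFn e Ω x 0 + α x * p) :
    ∀ x ∈ Ω, lowerExp e x = ((α x : ℝ) : EReal) := by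
  intro x hx
  set a : ℕ → ℝ := fun j =>
    Real.log (e j (dyadicIndex d j x)) / Real.log ((2 : ℝ) ^ (-(j : ℤ))) with ha
  set t := locScalingFn e Ω x 0
  have key : ∀ p : ℝ, ∀ᶠ j in atTop, t + α x * p - 1 < p * a j := fun p =>
    hreg.eventually_lt_of_lt_locScalingFn hΩo hΩb hx (by rw [haff x hx p]; linarith)
  have hlim : Tendsto a atTop (𝓝 (α x)) := by
    rw [Metric.tendsto_nhds]
    intro ε hε
    set N := (|t - 1| + 1) / ε
    have hN : 0 < N := by positivity
    have hNε : N * ε = |t - 1| + 1 := div_mul_cancel₀ _ hε.ne'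
    have hlow := neg_abs_le (t - 1)
    filter_upwards [key N, key (-N)] with j h1 h2
    rw [Real.dist_eq, abs_lt]
    constructor
    · refine lt_of_mul_lt_mul_left ?_ hN.le
      linarith
    · refine lt_of_mul_lt_mul_left ?_ hN.le
      linarith
  have hE : Tendsto (fun j => ((a j : ℝ) : EReal)) atTop (𝓝 ((α x : ℝ) : EReal)) :=
    (continuous_coe_real_ereal.tendsto _).comp hlim
  rw [← hE.liminf_eq]
  refine liminf_congr ?_
  filter_upwards [eventually_dyadicCube_subset hΩo hx] with j hj
  rw [if_neg (hreg.1 _ _ hj).ne']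

end
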